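/- (Table 1, row s = A₁A₁, carrying the cuspidal unipotent character ³D₄[−1]: the residue of the μ-function of G₂(3,1)[q] supporting the corresponding supercuspidal unipotent representation.) Let r be the point with α₁(r) = q and α₂(r) = −q^{−3}. Then r is a residual point: exactly the two roots −α₁ (with value q^{−1}) and 3α₁+2α₂ (with value q^{−3}) satisfy α(r) = q^{−m(α)}, exactly the two roots ±(3α₁+α₂) take the value −1, and no root takes the value 1, so that #{α : α(r) = q^{−m(α)}} + #{α : α(r) = −1} − #{α : α(r) = 1} − #{α : α(r) = −1} = 2. Moreover there exist a sign ε₀ ∈ {1, −1} and an integer k such that Res(r) = ε₀ · q^{k} / (Φ₂² Φ₆² Φ₁₂). -/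

import Mathlib

/-!
STATEMENT 18. Table 1, row `s = A₁A₁` (carrying the cuspidal unipotent character `³D₄[-1]`):
the point `r` with `α₁(r) = q`, `α₂(r) = -q⁻³` is a residual point — exactly the two roots
`-α₁` (value `q⁻¹`) and `3α₁+2α₂` (value `q⁻³`) satisfy `α(r) = q^{-m(α)}`, exactly
`±(3α₁+α₂)` take the value `-1`, no root takes the value `1`, so that
`#{α(r)=q^{-m(α)}} + #{α(r)=-1} - #{α(r)=1} - #{α(r)=-1} = 2` — and
`Res(r) = ± q^k / (Φ₂²Φ₆²Φ₁₂)`.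
-/

open scoped Classical

noncomputable section

/-- The field `ℚ(q)` (so `q` is transcendental over `ℚ`). -/
abbrev Kq : Type := RatFunc ℚ

/-- The indeterminate `q`. -/
def qG : Kq := RatFunc.X

/-- The `n`-th cyclotomic polynomial evaluated at `q`. -/
def Φ (n : ℕ) : Kq := Polynomial.aeval qG (Polynomial.cyclotomic n ℚ)

/-- The roots of the root system of type `G₂`, written in coordinates `(a, b)` for
`α = aα₁ + bα₂` with `α₁` short and `α₂` long. -/
def G2Roots : Finset (ℤ × ℤ) :=
  {(1, 0), (0, 1), (1, 1), (2, 1), (3, 1), (3, 2),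
   (-1, 0), (0, -1), (-1, -1), (-2, -1), (-3, -1), (-3, -2)}

/-- The short roots of `G₂`. -/
def G2Short : Finset (ℤ × ℤ) := {(1, 0), (1, 1), (2, 1), (-1, 0), (-1, -1), (-2, -1)}

/-- The parameters of `G₂(3,1)[q]`: `m(α) = 1` on short roots, `m(α) = 3` on long roots. -/
def mG2 (α : ℤ × ℤ) : ℤ := if α ∈ G2Short then 1 else 3

/-- Evaluation of the root `α = aα₁ + bα₂` at the point `r` with `α₁(r) = x`, `α₂(r) = y`. -/
def evG2 (x y : Kq) (α : ℤ × ℤ) : Kq := x ^ α.1 * y ^ α.2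

/-- The normalized regularized residue of the μ-function of `G₂(3,1)[q]` at the point `r`
with `α₁(r) = x`, `α₂(r) = y`; the normalization factor is `d = q²/((q-1)(q³-1))`. -/
def ResG2 (x y : Kq) : Kq :=
  (qG ^ 2 / ((qG - 1) * (qG ^ 3 - 1))) *
      (∏ α ∈ G2Roots.filter fun α => evG2 x y α ≠ 1, (1 - (evG2 x y α)⁻¹)) /
    ∏ α ∈ G2Roots.filter fun α => evG2 x y α ≠ qG ^ (-mG2 α),
      (1 - qG ^ (-mG2 α) * (evG2 x y α)⁻¹)

theorem qG_ne_zero : qG ≠ 0 := RatFunc.X_ne_zero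

theorem intDegree_qG_zpow (n : ℤ) : (qG ^ n).intDegree = n := by
  have hnat (k : ℕ) : (qG ^ k).intDegree = k := by
    induction k with
    | zero => simp
    | succ k ih =>
      rw [pow_succ, RatFunc.intDegree_mul (pow_ne_zero k qG_ne_zero) qG_ne_zero, ih, qG,
        RatFunc.intDegree_X]
      push_cast
      rfl
  obtain ⟨k, rfl | rfl⟩ := n.eq_nat_or_neg
  · rw [zpow_natCast, hnat]
  · rw [zpow_neg, zpow_natCast, RatFunc.intDegree_inv, hnat]

/-- A root takes the value `±q^(a - 3b)` at the point, with sign the parity of `b`. -/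
theorem evG2_eq (α : ℤ × ℤ) :
    evG2 qG (-qG ^ (-3 : ℤ)) α =
      if Even α.2 then qG ^ (α.1 - 3 * α.2) else -qG ^ (α.1 - 3 * α.2) := by
  have h : α.1 - 3 * α.2 = α.1 + -3 * α.2 := by ring
  rw [h, zpow_add₀ qG_ne_zero, zpow_mul]
  split_ifs with hb
  · simp only [evG2, hb.neg_zpow]
  · simp only [evG2, (Int.not_even_iff_odd.mp hb).neg_zpow, mul_neg]

theorem qG_zpow_inj {m n : ℤ} : qG ^ m = qG ^ n ↔ m = n := by
  refine ⟨fun h => ?_, fun h => by rw [h]⟩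
  simpa only [intDegree_qG_zpow] using congrArg RatFunc.intDegree h

theorem neg_qG_zpow_ne (m n : ℤ) : -qG ^ m ≠ qG ^ n := by
  intro h
  have hmn : m = n := by
    simpa only [RatFunc.intDegree_neg, intDegree_qG_zpow] using congrArg RatFunc.intDegree h
  subst hmn
  exact zpow_ne_zero m qG_ne_zero (neg_eq_self.mp h)

theorem evG2_eq_zpow_iff (α : ℤ × ℤ) (n : ℤ) :
    evG2 qG (-qG ^ (-3 : ℤ)) α = qG ^ n ↔ Even α.2 ∧ α.1 - 3 * α.2 = n := by
  rw [evG2_eq]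
  split_ifs with hb
  · simp only [qG_zpow_inj, hb, true_and]
  · simp only [neg_qG_zpow_ne, hb, false_and]

theorem evG2_eq_one_iff (α : ℤ × ℤ) :
    evG2 qG (-qG ^ (-3 : ℤ)) α = 1 ↔ Even α.2 ∧ α.1 - 3 * α.2 = 0 := by
  rw [← evG2_eq_zpow_iff, zpow_zero]

theorem evG2_eq_neg_one_iff (α : ℤ × ℤ) :
    evG2 qG (-qG ^ (-3 : ℤ)) α = -1 ↔ ¬ Even α.2 ∧ α.1 - 3 * α.2 = 0 := by
  rw [evG2_eq, ← zpow_zero qG]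
  split_ifs with hb
  · simp only [(neg_qG_zpow_ne 0 _).symm, hb, not_true, false_and]
  · simp only [neg_inj, qG_zpow_inj, hb, not_false_iff, true_and]

theorem Phi_two : Φ 2 = qG + 1 := by
  simp [Φ, Polynomial.cyclotomic_two]

theorem Phi_six : Φ 6 = qG ^ 2 - qG + 1 := by
  simp [Φ, Polynomial.cyclotomic_six]

theorem Phi_twelve : Φ 12 = qG ^ 4 - qG ^ 2 + 1 := by
  have h := Polynomial.cyclotomic_expand_eq_cyclotomic Nat.prime_two (by norm_num : 2 ∣ 6) ℚ
  simp only [Nat.reduceMul, Polynomial.cyclotomic_six, map_add, map_sub, map_pow, map_one,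
    Polynomial.expand_X] at h
  simp only [Φ, ← h, map_add, map_sub, map_pow, map_one, Polynomial.aeval_X]
  ring

theorem qG_pow_sub_one_ne_zero {n : ℕ} (hn : n ≠ 0) : qG ^ n - 1 ≠ 0 := by
  rw [sub_ne_zero]
  have h := (qG_zpow_inj (m := n) (n := 0)).not.mpr (by exact_mod_cast hn)
  simpa only [zpow_natCast, zpow_zero] using h

theorem qG_pow_add_one_ne_zero (n : ℕ) : qG ^ n + 1 ≠ 0 := by
  rw [ne_eq, add_eq_zero_iff_neg_eq]
  simpa only [zpow_natCast, zpow_zero] using neg_qG_zpow_ne n 0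

theorem filter_eq_param :
    G2Roots.filter (fun α => evG2 qG (-qG ^ (-3 : ℤ)) α = qG ^ (-mG2 α)) =
      ({(-1, 0), (3, 2)} : Finset (ℤ × ℤ)) := by
  simp only [evG2_eq_zpow_iff]
  simp [G2Roots, Finset.filter_insert, Finset.filter_singleton, mG2, G2Short, Int.even_iff,
    Finset.pair_comm]

theorem filter_eq_neg_one :
    G2Roots.filter (fun α => evG2 qG (-qG ^ (-3 : ℤ)) α = -1) =
      ({(3, 1), (-3, -1)} : Finset (ℤ × ℤ)) := by
  simp only [evG2_eq_neg_one_iff]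
  simp [G2Roots, Finset.filter_insert, Finset.filter_singleton, Int.even_iff]

theorem filter_eq_one :
    G2Roots.filter (fun α => evG2 qG (-qG ^ (-3 : ℤ)) α = 1) = ∅ := by
  simp only [evG2_eq_one_iff]
  simp [G2Roots, Finset.filter_insert, Finset.filter_singleton, Int.even_iff]

theorem ResG2_eq :
    ResG2 qG (-qG ^ (-3 : ℤ)) = qG ^ 17 / (Φ 2 ^ 2 * Φ 6 ^ 2 * Φ 12) := by
  have hne : G2Roots.filter (fun α => evG2 qG (-qG ^ (-3 : ℤ)) α ≠ 1) = G2Roots := by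
    rw [Finset.filter_not, filter_eq_one, Finset.sdiff_empty]
  have hpar : G2Roots.filter (fun α => evG2 qG (-qG ^ (-3 : ℤ)) α ≠ qG ^ (-mG2 α)) =
      {(1, 0), (0, 1), (1, 1), (2, 1), (3, 1), (0, -1), (-1, -1), (-2, -1), (-3, -1), (-3, -2)} := by
    rw [Finset.filter_not, filter_eq_param]
    decide
  rw [ResG2, hne, hpar]
  rw [Phi_two, Phi_six, Phi_twelve]
  simp [G2Roots, evG2, mG2, G2Short]
  have h0 := qG_ne_zero
  have h1 : 1 + qG ≠ 0 := by simpa [add_comm] using qG_pow_add_one_ne_zero 1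
  have h2 : qG ^ 2 - 1 ≠ 0 := qG_pow_sub_one_ne_zero (by norm_num)
  have h6 : qG ^ 6 - 1 ≠ 0 := qG_pow_sub_one_ne_zero (by norm_num)
  have hsix : qG * (qG - 1) + 1 ≠ 0 := by
    have h : qG ^ 3 + 1 = (qG + 1) * (qG * (qG - 1) + 1) := by ring
    exact right_ne_zero_of_mul (h ▸ qG_pow_add_one_ne_zero 3)
  have htwelve : qG ^ 2 * (qG ^ 2 - 1) + 1 ≠ 0 := by
    have h : qG ^ 6 + 1 = (qG ^ 2 + 1) * (qG ^ 2 * (qG ^ 2 - 1) + 1) := by ring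
    exact right_ne_zero_of_mul (h ▸ qG_pow_add_one_ne_zero 6)
  have h1' : qG - 1 ≠ 0 := by simpa using qG_pow_sub_one_ne_zero one_ne_zero
  have h3 : qG ^ 3 - 1 ≠ 0 := qG_pow_sub_one_ne_zero three_ne_zero
  have h1'' : qG + 1 ≠ 0 := by simpa using qG_pow_add_one_ne_zero 1
  have h2' := qG_pow_add_one_ne_zero 2
  have h3' := qG_pow_add_one_ne_zero 3
  have h6' := qG_pow_add_one_ne_zero 6
  field_simp
  ring

theorem statement18 :
    G2Roots.filter (fun α => evG2 qG (-qG ^ (-3 : ℤ)) α = qG ^ (-mG2 α)) =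
        ({(-1, 0), (3, 2)} : Finset (ℤ × ℤ)) ∧
      G2Roots.filter (fun α => evG2 qG (-qG ^ (-3 : ℤ)) α = -1) =
        ({(3, 1), (-3, -1)} : Finset (ℤ × ℤ)) ∧
      G2Roots.filter (fun α => evG2 qG (-qG ^ (-3 : ℤ)) α = 1) = ∅ ∧
      ((G2Roots.filter (fun α => evG2 qG (-qG ^ (-3 : ℤ)) α = qG ^ (-mG2 α))).card : ℤ) +
          (G2Roots.filter (fun α => evG2 qG (-qG ^ (-3 : ℤ)) α = -1)).card -
          (G2Roots.filter (fun α => evG2 qG (-qG ^ (-3 : ℤ)) α = 1)).card -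
          (G2Roots.filter (fun α => evG2 qG (-qG ^ (-3 : ℤ)) α = -1)).card = 2 ∧
      ∃ ε₀ : Kq, (ε₀ = 1 ∨ ε₀ = -1) ∧ ∃ k : ℤ,
        ResG2 qG (-qG ^ (-3 : ℤ)) = ε₀ * qG ^ k / (Φ 2 ^ 2 * Φ 6 ^ 2 * Φ 12) := by
  refine ⟨filter_eq_param, filter_eq_neg_one, filter_eq_one, ?_, 1, Or.inl rfl, 17, ?_⟩
  · rw [filter_eq_param, filter_eq_neg_one, filter_eq_one]
    rfl
  · rw [ResG2_eq, one_mul]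
    norm_cast
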